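/- arXiv:1606.06765 — 4 statements merged into one kernel-verified Lean document; each statement's English description precedes it below -/
import Mathlib

section
/- Let k be a positive integer. If D[X,Y] is a k-loose spine digraph, then α_k(D) ≥ |Y| + min(|X|, k). -/
/-- `p` is a directed path in the digraph with arc relation `A`:
a list of pairwise distinct vertices with consecutive arcs. -/
def IsDipath {V : Type*} (A : V → V → Prop) (p : List V) : Prop :=
  p.Nodup ∧ p.Chain' A

/-- `u` and `v` are adjacent: there is an arc between them in some direction. -/
def DiAdj {V : Type*} (A : V → V → Prop) (u v : V) : Prop := A u v ∨ A v u

/-- A stable set: pairwise non-adjacent vertices. -/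
def IsStableSet {V : Type*} (A : V → V → Prop) (S : Set V) : Prop :=
  ∀ u ∈ S, ∀ v ∈ S, u ≠ v → ¬ DiAdj A u v

/-- A path partition of the digraph: a family of nonempty vertex-disjoint
directed paths covering all vertices. -/
def IsPathPartition {V : Type*} (A : V → V → Prop) (Part : Finset (List V)) : Prop :=
  (∀ p ∈ Part, IsDipath A p ∧ p ≠ []) ∧
  (∀ p ∈ Part, ∀ q ∈ Part, p ≠ q → ∀ v : V, v ∈ p → v ∉ q) ∧
  (∀ v : V, ∃ p ∈ Part, v ∈ p)

/-- The `k`-norm of a path partition: `∑_{P ∈ Part} min (|P|, k)`. -/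
def kNorm {V : Type*} (k : ℕ) (Part : Finset (List V)) : ℕ :=
  ∑ p ∈ Part, min p.length k

/-- `π_k(D)`: the minimum `k`-norm of a path partition. -/
noncomputable def piK {V : Type*} (A : V → V → Prop) (k : ℕ) : ℕ :=
  sInf {n | ∃ Part : Finset (List V), IsPathPartition A Part ∧ kNorm k Part = n}

/-- A `k`-partial coloring: `k` pairwise disjoint stable color classes
(possibly empty). -/
def IsKPartialColoring {V : Type*} (A : V → V → Prop) (k : ℕ) (C : Fin k → Finset V) : Prop :=
  (∀ i, IsStableSet A ((C i : Finset V) : Set V)) ∧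
  ∀ i j, i ≠ j → Disjoint (C i) (C j)

/-- `α_k(D)`: the maximum weight (total size) of a `k`-partial coloring. -/
noncomputable def alphaK {V : Type*} (A : V → V → Prop) (k : ℕ) : ℕ :=
  sSup {n | ∃ C : Fin k → Finset V, IsKPartialColoring A k C ∧ ∑ i, (C i).card = n}

/-- `{X, Y}` witnesses that the digraph is a spine digraph: `X` and `Y`
partition the vertex set, the subdigraph induced by `X` is traceable
(has a Hamiltonian directed path), and `Y` is stable. -/
def IsSpinePartition {V : Type*} (A : V → V → Prop) (X Y : Finset V) : Prop :=
  (∀ v : V, v ∈ X ↔ v ∉ Y) ∧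
  (∃ p : List V, IsDipath A p ∧ ∀ v : V, v ∈ p ↔ v ∈ X) ∧
  IsStableSet A (Y : Set V)

/-- A spine digraph `D[X,Y]` is `k`-loose if `|X| < k` or some `k`-subset `S` of
`X` is such that no `y ∈ Y` is adjacent to every vertex of `S`. -/
def IsKLoose {V : Type*} (A : V → V → Prop) (k : ℕ) (X Y : Finset V) : Prop :=
  X.card < k ∨ ∃ S ⊆ X, S.card = k ∧ ∀ y ∈ Y, ∃ x ∈ S, ¬ DiAdj A y x

/-- A Hamiltonian path `p` of `D[X]` is zigzag-free in `D` if no `y ∈ Y` has an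
arc into the first vertex, no arc from the last vertex into `y`, and there is no
`i` with arcs `(p_i, y)` and `(y, p_{i+1})`. -/
def ZigzagFree {V : Type*} (A : V → V → Prop) (Y : Finset V) (p : List V) : Prop :=
  ∀ y ∈ Y,
    (∀ h : p ≠ [], ¬ A y (p.head h)) ∧
    (∀ h : p ≠ [], ¬ A (p.getLast h) y) ∧
    (∀ i : ℕ, ∀ hi : i + 1 < p.length,
      ¬ (A (p.get ⟨i, Nat.lt_of_succ_lt hi⟩) y ∧ A y (p.get ⟨i + 1, hi⟩)))

/-- If `S` is injectively coloured with `k` colours, and each vertex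
of the stable set `Y` gets a colour whose class in `S` it is not adjacent to, then
`S ∪ Y` is the union of a `k`-partial coloring. -/
theorem exists_kPartialColoring_of_injOn {V : Type*} [DecidableEq V] {A : V → V → Prop}
    {S Y : Finset V} (hSY : Disjoint S Y) (hY : IsStableSet A (Y : Set V)) {k : ℕ}
    {c : V → Fin k} (hc : Set.InjOn c S)
    (hcY : ∀ y ∈ Y, ∃ i, ∀ x ∈ S, c x = i → ¬ DiAdj A y x) :
    ∃ C : Fin k → Finset V, IsKPartialColoring A k C ∧ ∑ i, (C i).card = Y.card + S.card := by
  have hne : ∀ v ∈ Y, v ∉ S := fun v hv hvS => Finset.disjoint_left.mp hSY hvS hv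
  have hcY' : ∀ y, ∃ i, y ∈ Y → ∀ x ∈ S, c x = i → ¬ DiAdj A y x := fun y => by
    by_cases hy : y ∈ Y
    · exact (hcY y hy).imp fun _ h _ => h
    · exact ⟨c y, fun h => absurd h hy⟩
  choose g hg using hcY'
  let col : V → Fin k := fun v => if v ∈ S then c v else g v
  refine ⟨fun i => {v ∈ S ∪ Y | col v = i}, ⟨?_, ?_⟩, ?_⟩
  · intro i u hu v hv huv
    simp only [col, Finset.coe_filter, Finset.mem_union, Set.mem_ofPred_eq] at hu hv
    obtain ⟨hu, hui⟩ := hu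
    obtain ⟨hv, hvi⟩ := hv
    rcases hu with hu | hu <;> rcases hv with hv | hv
    · rw [if_pos hu] at hui
      rw [if_pos hv] at hvi
      exact absurd (hc hu hv (hui.trans hvi.symm)) huv
    · rw [if_pos hu] at hui
      rw [if_neg (hne v hv)] at hvi
      exact fun h => hg v hv u hu (hui.trans hvi.symm) (Or.symm h)
    · rw [if_neg (hne u hu)] at hui
      rw [if_pos hv] at hvi
      exact hg u hu v hv (hvi.trans hui.symm)
    · exact hY u hu v hv huv
  · intro i j hij
    exact Finset.disjoint_filter.mpr fun v _ hi hj => hij (hi.symm.trans hj)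
  · rw [← Finset.card_eq_sum_card_fiberwise (fun v _ => Finset.mem_coe.mpr (Finset.mem_univ _)),
      Finset.card_union_of_disjoint hSY, add_comm]

/-- The weight of a `k`-partial coloring of a finite digraph is at most `α_k`. -/
theorem IsKPartialColoring.sum_card_le_alphaK {V : Type*} [Fintype V]
    {A : V → V → Prop} {k : ℕ} {C : Fin k → Finset V} (hC : IsKPartialColoring A k C) :
    ∑ i, (C i).card ≤ alphaK A k := by
  refine le_csSup ⟨∑ _i : Fin k, Fintype.card V, ?_⟩ ⟨C, hC, rfl⟩
  rintro n ⟨C', -, rfl⟩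
  exact Finset.sum_le_sum fun i _ => (C' i).card_le_univ

/-- A finite set with at most `k` elements can be injectively coloured with `k > 0` colours. -/
theorem Finset.exists_injOn_fin {V : Type*} (S : Finset V) {k : ℕ} (hk : 0 < k)
    (hS : S.card ≤ k) : ∃ c : V → Fin k, Set.InjOn c S := by
  classical
  refine ⟨fun v => if h : v ∈ S then Fin.castLE hS (S.equivFin ⟨v, h⟩) else ⟨0, hk⟩, ?_⟩
  intro u hu v hv huv
  rw [Finset.mem_coe] at hu hv
  simpa [hu, hv] using huv

/-- For a positive integer `k`, if `D[X,Y]` is a `k`-loose spine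
digraph then `α_k(D) ≥ |Y| + min(|X|, k)`. -/
theorem kloose_alphaK_ge {V : Type*} [Fintype V] [DecidableEq V]
    (A : V → V → Prop) (hloopless : Irreflexive A)
    (X Y : Finset V) (hspine : IsSpinePartition A X Y)
    (k : ℕ) (hk : 0 < k) (hloose : IsKLoose A k X Y) :
    Y.card + min X.card k ≤ alphaK A k := by
  have hdisj : Disjoint X Y := Finset.disjoint_left.mpr fun v hv => (hspine.1 v).mp hv
  obtain ⟨S, hSX, hcard, c, hc, hcY⟩ : ∃ S ⊆ X, S.card = min X.card k ∧
      ∃ c : V → Fin k, Set.InjOn c S ∧ ∀ y ∈ Y, ∃ i, ∀ x ∈ S, c x = i → ¬ DiAdj A y x := by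
    rcases hloose with hlt | ⟨S, hSX, hS, hnadj⟩
    · obtain ⟨c, hc⟩ := X.exists_injOn_fin hk hlt.le
      refine ⟨X, subset_rfl, (min_eq_left hlt.le).symm, c, hc, fun y _ => ?_⟩
      obtain ⟨i, -, hi⟩ := Finset.exists_mem_notMem_of_card_lt_card
        (s := X.image c) (t := Finset.univ)
        (Finset.card_image_le.trans_lt (by simpa using hlt))
      exact ⟨i, fun x hx hxi => absurd (hxi ▸ Finset.mem_image_of_mem c hx) hi⟩
    · obtain ⟨c, hc⟩ := S.exists_injOn_fin hk hS.le
      refine ⟨S, hSX, ?_, c, hc, fun y hy => ?_⟩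
      · rw [hS, min_eq_right (hS ▸ Finset.card_le_card hSX)]
      · obtain ⟨x, hx, hxy⟩ := hnadj y hy
        exact ⟨c x, fun x' hx' h => hc hx' hx h ▸ hxy⟩
  obtain ⟨C, hC, hsum⟩ :=
    exists_kPartialColoring_of_injOn (hdisj.mono_left hSX) hspine.2.2 hc hcY
  rw [← hcard, ← hsum]
  exact hC.sum_card_le_alphaK
end

section
/- Let k be a positive integer. If D[X,Y] is a k-loose spine digraph, then π_k(D) ≤ α_k(D). -/
lemma piK_le_kNorm {V : Type*} {A : V → V → Prop} {Part : Finset (List V)} (k : ℕ)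
    (h : IsPathPartition A Part) : piK A k ≤ kNorm k Part :=
  Nat.sInf_le ⟨Part, h, rfl⟩

lemma isDipath_singleton {V : Type*} (A : V → V → Prop) (v : V) : IsDipath A [v] :=
  ⟨List.nodup_singleton v, List.isChain_singleton v⟩

/-- The path partition into single vertices. -/
lemma piK_le_card {V : Type*} [Fintype V] [DecidableEq V] (A : V → V → Prop) (k : ℕ) :
    piK A k ≤ Fintype.card V := by
  have h : IsPathPartition A (Finset.univ.image fun v : V => [v]) := by
    refine ⟨?_, ?_, ?_⟩
    · simp [isDipath_singleton]
    · simp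
    · simp
  refine (piK_le_kNorm k h).trans ?_
  calc kNorm k (Finset.univ.image fun v : V => [v])
      ≤ ∑ _p ∈ Finset.univ.image (fun v : V => [v]), 1 := by
        refine Finset.sum_le_sum fun p hp => ?_
        obtain ⟨v, -, rfl⟩ := Finset.mem_image.1 hp
        simp
    _ ≤ Fintype.card V := by
        simpa using Finset.card_image_le (s := Finset.univ) (f := fun v : V => [v])

/-- The path partition into a Hamiltonian path of `D[X]` and the single vertices of `Y`. -/
lemma piK_le_add_card_of_isSpinePartition {V : Type*} [DecidableEq V] {A : V → V → Prop}
    {X Y : Finset V} (hspine : IsSpinePartition A X Y) (hX : X.Nonempty) (k : ℕ) :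
    piK A k ≤ k + Y.card := by
  obtain ⟨hXY, ⟨p, hp, hpX⟩, -⟩ := hspine
  have hpne : p ≠ [] := by
    rintro rfl
    obtain ⟨x, hx⟩ := hX
    simpa using (hpX x).2 hx
  have hpY : p ∉ Y.image fun v => [v] := by
    intro h
    obtain ⟨y, hy, rfl⟩ := Finset.mem_image.1 h
    exact (hXY y).1 ((hpX y).1 (by simp)) hy
  have h : IsPathPartition A (insert p (Y.image fun v => [v])) := by
    refine ⟨?_, ?_, ?_⟩
    · simp [isDipath_singleton, hp, hpne]
    · simp only [Finset.mem_insert, Finset.mem_image]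
      rintro q (rfl | ⟨y, hy, rfl⟩) r (rfl | ⟨z, hz, rfl⟩) hqr v hv hv' <;> grind
    · intro v
      by_cases hv : v ∈ Y
      · exact ⟨[v], by simp [hv], by simp⟩
      · exact ⟨p, by simp, (hpX v).2 ((hXY v).2 hv)⟩
  refine (piK_le_kNorm k h).trans ?_
  rw [kNorm, Finset.sum_insert hpY]
  refine add_le_add (min_le_right _ _) ?_
  calc ∑ q ∈ Y.image (fun v => [v]), min q.length k
      ≤ ∑ _q ∈ Y.image (fun v => [v]), 1 := by
        refine Finset.sum_le_sum fun q hq => ?_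
        obtain ⟨v, -, rfl⟩ := Finset.mem_image.1 hq
        simp
    _ ≤ Y.card := by
        simpa using Finset.card_image_le (s := Y) (f := fun v => [v])

/-- A proper coloring of `D[W]` with `k` colors bounds `α_k(D)` from below by `|W|`. -/
lemma card_le_alphaK {V : Type*} [Fintype V] [DecidableEq V] {A : V → V → Prop} {k : ℕ}
    (W : Finset V) (f : V → Fin k)
    (hf : ∀ u ∈ W, ∀ v ∈ W, u ≠ v → f u = f v → ¬ DiAdj A u v) :
    W.card ≤ alphaK A k := by
  refine le_csSup ⟨Fintype.card V, ?_⟩ ⟨fun i => W.filter (f · = i), ⟨?_, ?_⟩, ?_⟩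
  · rintro n ⟨C, hC, rfl⟩
    rw [← Finset.card_biUnion fun i _ j _ hij => hC.2 i j hij]
    exact Finset.card_le_univ _
  · intro i u hu v hv huv
    simp only [Finset.coe_filter, Set.mem_ofPred_eq] at hu hv
    exact hf u hu.1 v hv.1 huv (hu.2.trans hv.2.symm)
  · intro i j hij
    rw [Finset.disjoint_left]
    grind
  · exact (Finset.card_eq_sum_card_fiberwise fun _ _ => Finset.mem_univ _).symm

/-- For a positive integer `k`, if `D[X,Y]` is a `k`-loose spine
digraph then `π_k(D) ≤ α_k(D)`. -/
theorem kloose_linial {V : Type*} [Fintype V] [DecidableEq V]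
    (A : V → V → Prop) (hloopless : Irreflexive A)
    (X Y : Finset V) (hspine : IsSpinePartition A X Y)
    (k : ℕ) (hk : 0 < k) (hloose : IsKLoose A k X Y) :
    piK A k ≤ alphaK A k := by
  have hXY := hspine.1
  have hstab := hspine.2.2
  rcases hloose with hlt | ⟨S, hSX, hS, hYS⟩
  · obtain ⟨e⟩ : Nonempty (Option X ↪ Fin k) :=
      Function.Embedding.nonempty_of_card_le (by simpa using hlt)
    refine (piK_le_card A k).trans
      (card_le_alphaK Finset.univ (fun v => if h : v ∈ X then e (some ⟨v, h⟩) else e none) ?_)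
    intro u _ v _ huv hc
    by_cases hu : u ∈ X <;> by_cases hv : v ∈ X <;> simp [hu, hv] at hc
    · exact absurd hc huv
    · exact hstab u (by grind) v (by grind) huv
  · have hSne : S.Nonempty := Finset.card_pos.1 (hS ▸ hk)
    refine (piK_le_add_card_of_isSpinePartition hspine (hSne.mono hSX) k).trans ?_
    have hdisj : Disjoint S Y := Finset.disjoint_left.2 fun v hv => (hXY v).1 (hSX hv)
    choose! g hgS hg using hYS
    let e := S.equivFinOfCardEq hS
    have he : ∀ u (hu : u ∈ S) v (hv : v ∈ S), e ⟨u, hu⟩ = e ⟨v, hv⟩ → u = v := by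
      intro u hu v hv h
      simpa using h
    have hcard : (S ∪ Y).card = k + Y.card := by rw [Finset.card_union_of_disjoint hdisj, hS]
    rw [← hcard]
    let f : V → Fin k := fun v =>
      if h : v ∈ S then e ⟨v, h⟩ else if h : v ∈ Y then e ⟨g v, hgS v h⟩ else ⟨0, hk⟩
    have hfS : ∀ v (h : v ∈ S), f v = e ⟨v, h⟩ := fun v h => by simp [f, h]
    have hfY : ∀ v (h : v ∈ Y), f v = e ⟨g v, hgS v h⟩ := fun v h => by
      simp [f, h, Finset.disjoint_right.1 hdisj h]
    refine card_le_alphaK _ f ?_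
    intro u hu v hv huv hc
    rcases Finset.mem_union.1 hu with hu | hu <;> rcases Finset.mem_union.1 hv with hv | hv
    · rw [hfS u hu, hfS v hv] at hc
      exact absurd (he _ _ _ _ hc) huv
    · rw [hfS u hu, hfY v hv] at hc
      rw [he _ _ _ _ hc]
      exact fun h => hg v hv h.symm
    · rw [hfY u hu, hfS v hv] at hc
      rw [← he _ _ _ _ hc]
      exact hg u hu
    · exact hstab u hu v hv huv
end

section
/- Let D[X,Y] be a spine digraph and let k be a positive integer. If λ(D) > |X|, i.e. D contains a directed path with more than |X| vertices, then π_k(D) ≤ α_k(D). -/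
/-- A nonempty directed path `p`, together with the vertices off `p` as trivial paths, forms a path
partition; this bounds `π_k` from above. -/
theorem piK_le_of_isDipath {V : Type*} [Fintype V] [DecidableEq V] {A : V → V → Prop} (k : ℕ)
    {p : List V} (hp : IsDipath A p) (hne : p ≠ []) :
    piK A k ≤ min p.length k + (Fintype.card V - p.length) := by
  set R : Finset V := Finset.univ \ p.toFinset with hR
  have hRcard : R.card = Fintype.card V - p.length := by
    rw [hR, Finset.card_sdiff_of_subset (Finset.subset_univ _), List.toFinset_card_of_nodup hp.1,
      Finset.card_univ]
  have hmemR : ∀ v, v ∈ R ↔ v ∉ p := by simp [hR]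
  let S : Finset (List V) := R.image fun v => [v]
  have hpart : IsPathPartition A (insert p S) := by
    refine ⟨?_, ?_, ?_⟩
    · intro q hq
      rcases Finset.mem_insert.1 hq with rfl | hq
      · exact ⟨hp, hne⟩
      · obtain ⟨v, -, rfl⟩ := Finset.mem_image.1 hq
        exact ⟨⟨List.nodup_singleton v, List.isChain_singleton v⟩, List.cons_ne_nil _ _⟩
    · intro q hq r hr hqr v hvq hvr
      rcases Finset.mem_insert.1 hq with rfl | hq <;> rcases Finset.mem_insert.1 hr with rfl | hr
      · exact hqr rfl
      · obtain ⟨w, hw, rfl⟩ := Finset.mem_image.1 hr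
        exact (hmemR w).1 hw (List.mem_singleton.1 hvr ▸ hvq)
      · obtain ⟨w, hw, rfl⟩ := Finset.mem_image.1 hq
        exact (hmemR w).1 hw (List.mem_singleton.1 hvq ▸ hvr)
      · obtain ⟨w, -, rfl⟩ := Finset.mem_image.1 hq
        obtain ⟨u, -, rfl⟩ := Finset.mem_image.1 hr
        rw [← List.mem_singleton.1 hvq, ← List.mem_singleton.1 hvr] at hqr
        exact hqr rfl
    · intro v
      by_cases hv : v ∈ p
      · exact ⟨p, Finset.mem_insert_self _ _, hv⟩
      · exact ⟨[v], Finset.mem_insert_of_mem (Finset.mem_image_of_mem _ ((hmemR v).2 hv)),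
          List.mem_singleton_self v⟩
  have hpS : p ∉ S := by
    intro h
    obtain ⟨v, hv, rfl⟩ := Finset.mem_image.1 h
    exact (hmemR v).1 hv (List.mem_singleton_self v)
  have hsum : ∑ q ∈ S, min q.length k ≤ R.card := by
    calc ∑ q ∈ S, min q.length k ≤ ∑ _q ∈ S, 1 := by
          refine Finset.sum_le_sum fun q hq => ?_
          obtain ⟨v, -, rfl⟩ := Finset.mem_image.1 hq
          simp
      _ = S.card := by simp
      _ ≤ R.card := Finset.card_image_le
  calc piK A k ≤ kNorm k (insert p S) := Nat.sInf_le ⟨_, hpart, rfl⟩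
    _ = min p.length k + ∑ q ∈ S, min q.length k := Finset.sum_insert hpS
    _ ≤ _ := by omega

/-- The weight of a `k`-partial coloring is a lower bound for `α_k`. -/
theorem IsKPartialColoring.weight_le_alphaK {V : Type*} [Fintype V] [DecidableEq V]
    {A : V → V → Prop} {k : ℕ} {C : Fin k → Finset V} (hC : IsKPartialColoring A k C) :
    ∑ i, (C i).card ≤ alphaK A k := by
  refine le_csSup ⟨Fintype.card V, ?_⟩ ⟨C, hC, rfl⟩
  rintro n ⟨C', hC', rfl⟩
  rw [← Finset.card_biUnion fun i _ j _ hij => hC'.2 i j hij]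
  exact Finset.card_le_univ _

/-- Coloring a stable set `Y` with one color and up to `k - 1` further vertices with one color each
bounds `α_k` from below. -/
theorem card_add_card_le_alphaK {V : Type*} [Fintype V] [DecidableEq V] {A : V → V → Prop} {k : ℕ}
    {Y T : Finset V} (hY : IsStableSet A (Y : Set V)) (hYT : Disjoint Y T) (hT : T.card < k) :
    Y.card + T.card ≤ alphaK A k := by
  have : NeZero k := ⟨by omega⟩
  obtain ⟨e⟩ : Nonempty (T ↪ {i : Fin k // i ≠ 0}) := by
    refine Function.Embedding.nonempty_of_card_le ?_
    have : Fintype.card {i : Fin k // i ≠ 0} = k - 1 := by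
      simp [Fintype.card_subtype_compl]
    rw [this, Fintype.card_coe]
    omega
  let g : V → Fin k := fun v => if h : v ∈ T then e ⟨v, h⟩ else 0
  have hg : ∀ {v}, v ∈ Y ∪ T → g v = 0 → v ∈ Y := by
    intro v hv h0
    by_contra hvY
    have hvT : v ∈ T := (Finset.mem_union.1 hv).resolve_left hvY
    simp only [g, dif_pos hvT] at h0
    exact (e ⟨v, hvT⟩).2 h0
  have hC : IsKPartialColoring A k fun i => (Y ∪ T).filter fun v => g v = i := by
    refine ⟨fun i u hu v hv huv => ?_, fun i j hij => ?_⟩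
    · obtain ⟨hu', rfl⟩ := Finset.mem_filter.1 (Finset.mem_coe.1 hu)
      obtain ⟨hv', hvu⟩ := Finset.mem_filter.1 (Finset.mem_coe.1 hv)
      by_cases h0 : g u = 0
      · exact hY u (hg hu' h0) v (hg hv' (hvu.trans h0)) huv
      · have huT : u ∈ T := by
          by_contra h
          exact h0 (dif_neg h)
        have hvT : v ∈ T := by
          by_contra h
          exact h0 (hvu.symm.trans (dif_neg h))
        simp only [g, dif_pos huT, dif_pos hvT] at hvu
        exact absurd (congrArg Subtype.val (e.injective (Subtype.ext hvu))).symm huv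
    · refine Finset.disjoint_left.2 fun v hi hj => hij ?_
      exact (Finset.mem_filter.1 hi).2.symm.trans (Finset.mem_filter.1 hj).2
  rw [← Finset.card_union_of_disjoint hYT,
    Finset.card_eq_sum_card_fiberwise (t := Finset.univ) (f := g) fun _ _ => by simp]
  exact hC.weight_le_alphaK

/-- For a spine digraph `D[X,Y]` and a positive integer `k`, if `D`
has a directed path with more than `|X|` vertices (`λ(D) > |X|`), then
`π_k(D) ≤ α_k(D)`. -/
theorem long_path_linial {V : Type*} [Fintype V] [DecidableEq V]
    (A : V → V → Prop) (hloopless : Irreflexive A)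
    (X Y : Finset V) (hspine : IsSpinePartition A X Y)
    (k : ℕ) (hk : 0 < k)
    (hlong : ∃ p : List V, IsDipath A p ∧ X.card < p.length) :
    piK A k ≤ alphaK A k := by
  obtain ⟨p, hp, hlen⟩ := hlong
  obtain ⟨hXY, -, hY⟩ := hspine
  have hne : p ≠ [] := List.ne_nil_of_length_pos (by omega)
  have hX : X = Yᶜ := by
    ext v
    rw [Finset.mem_compl, hXY]
  have hcard : Y.card + X.card = Fintype.card V := by
    rw [hX, Finset.card_add_card_compl]
  obtain ⟨T, hTX, hT⟩ := Finset.exists_subset_card_eq (min_le_left X.card (k - 1))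
  have hYT : Disjoint Y T :=
    Finset.disjoint_left.2 fun v hvY hvT => (hXY v).1 (hTX hvT) hvY
  have hα := card_add_card_le_alphaK hY hYT (k := k) (by omega)
  have hπ := piK_le_of_isDipath k hp hne
  have hpV : p.length ≤ Fintype.card V := hp.1.length_le_card
  omega
end

section
/- Let k be a positive integer, let D[X,Y] be a k-tight spine digraph, and let P = (x_1, x_2, …, x_ℓ) be a Hamiltonian path of D[X] that is zigzag-free in D. Then there exist directed paths P_1 and P_2 in D such that: (i) V(P_1) ∩ V(P_2) = ∅; (ii) |P_1| + |P_2| = |X| + k + 1; (iii) the set of terminal vertices of P_1 and P_2 is {x_ℓ, y} for some y ∈ Y; and (iv) X ⊆ V(P_1) ∪ V(P_2). -/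
/-- The zigzag-free condition for a single outside vertex `y`, with the interior part
phrased as a chain condition. -/
def ZigzagFreeAt {V : Type*} (A : V → V → Prop) (y : V) (p : List V) : Prop :=
  (∀ v ∈ p.head?, ¬ A y v) ∧ (∀ v ∈ p.getLast?, ¬ A v y) ∧
    p.IsChain (fun a b => ¬ (A a y ∧ A y b))

theorem ZigzagFree.zigzagFreeAt {V : Type*} {A : V → V → Prop} {Y : Finset V} {p : List V}
    (h : ZigzagFree A Y p) {y : V} (hy : y ∈ Y) : ZigzagFreeAt A y p := by
  obtain ⟨hhead, hlast, hmid⟩ := h y hy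
  refine ⟨fun v hv => ?_, fun v hv => ?_, ?_⟩
  · have hne : p ≠ [] := by
      rintro rfl
      simp at hv
    rw [List.head?_eq_some_head hne, Option.mem_some_iff] at hv
    exact hv ▸ hhead hne
  · obtain ⟨hne, rfl⟩ := List.mem_getLast?_eq_getLast hv
    exact hlast hne
  · rw [List.isChain_iff_getElem]
    intro i hi
    exact hmid i hi

/-- A list with an element satisfying `Q` splits at its last such element. -/
theorem List.exists_split_at_last {α : Type*} {Q : α → Prop} (l : List α)
    (h : ∃ a ∈ l, Q a) : ∃ l₁ a l₂, l = l₁ ++ a :: l₂ ∧ Q a ∧ ∀ v ∈ l₂, ¬ Q v := by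
  induction l with
  | nil => simp at h
  | cons c t ih =>
    by_cases ht : ∃ a ∈ t, Q a
    · obtain ⟨l₁, a, l₂, rfl, ha, hl₂⟩ := ih ht
      exact ⟨c :: l₁, a, l₂, rfl, ha, hl₂⟩
    · push Not at ht
      obtain ⟨a, hat, ha⟩ := h
      rcases List.mem_cons.1 hat with rfl | hat
      · exact ⟨[], a, t, rfl, ha, ht⟩
      · exact absurd ha (ht a hat)

/-- Out-arcs to `y` propagate along a zigzag-free stretch of neighbours of `y`. -/
theorem arc_to_of_mem_of_isChain {V : Type*} {A : V → V → Prop} {y : V} {l : List V} {c : V}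
    (hc : A c y) (hadj : ∀ v ∈ l, DiAdj A y v)
    (hch : (c :: l).IsChain (fun a b => ¬ (A a y ∧ A y b))) : ∀ v ∈ l, A v y := by
  induction l generalizing c with
  | nil => simp
  | cons d t ih =>
    rw [List.isChain_cons_cons] at hch
    have hd : A d y := (hadj d (by simp)).resolve_left fun h => hch.1 ⟨hc, h⟩
    intro v hv
    rcases List.mem_cons.1 hv with rfl | hv
    · exact hd
    · exact ih hd (fun w hw => hadj w (by simp [hw])) hch.2 v hv

theorem ZigzagFreeAt.arc_to {V : Type*} {A : V → V → Prop} {y : V} {l r : List V}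
    (h : ZigzagFreeAt A y (l ++ r)) (hadj : ∀ v ∈ l, DiAdj A y v) : ∀ v ∈ l, A v y := by
  cases l with
  | nil => simp
  | cons c t =>
    have hc : A c y := (hadj c (by simp)).resolve_left (h.1 c (by simp))
    intro v hv
    rcases List.mem_cons.1 hv with rfl | hv
    · exact hc
    · exact arc_to_of_mem_of_isChain hc (fun w hw => hadj w (by simp [hw]))
        (List.isChain_append.1 h.2.2).1 v hv

/-- In a `k`-tight situation every sublist of at most `k` path vertices has a common
neighbour. -/
theorem exists_common_neighbor_of_length_le {V : Type*} [DecidableEq V] {A : V → V → Prop}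
    {Y : Finset V} {k : ℕ} {p q : List V} (hnd : p.Nodup) (hk : k ≤ p.length)
    (htight : ∀ S ⊆ p.toFinset, S.card = k → ∃ y ∈ Y, ∀ x ∈ S, DiAdj A y x)
    (hq : q ⊆ p) (hqk : q.length ≤ k) : ∃ y ∈ Y, ∀ x ∈ q, DiAdj A y x := by
  have hsub : q.toFinset ⊆ p.toFinset := fun x hx => by
    rw [List.mem_toFinset] at hx ⊢
    exact hq hx
  obtain ⟨S, hqS, hSp, hS⟩ := Finset.exists_subsuperset_card_eq hsub
    (q.toFinset_card_le.trans hqk) (by rwa [List.toFinset_card_of_nodup hnd])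
  obtain ⟨y, hy, hyS⟩ := htight S hSp hS
  exact ⟨y, hy, fun x hx => hyS x (hqS (List.mem_toFinset.2 hx))⟩

theorem IsDipath.append {V : Type*} {A : V → V → Prop} {p q : List V} {a b : V}
    (hp : IsDipath A p) (hq : IsDipath A q) (hdisj : ∀ v ∈ p, v ∉ q)
    (ha : p.getLast? = some a) (hb : q.head? = some b) (hab : A a b) :
    IsDipath A (p ++ q) := by
  refine ⟨hp.1.append hq.1 hdisj, List.isChain_append.2 ⟨hp.2, hq.2, ?_⟩⟩
  simp [ha, hb, hab]

/-- List form of the two-path theorem, also allowing `k = 0`. The induction on `k` splits the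
path at its last vertex `a` having an out-neighbour in `Y`, and replaces `Y` by the
in-neighbours of the successor `b` of `a`. -/
theorem exists_two_paths_of_zigzagFreeAt {V : Type*} [DecidableEq V] {A : V → V → Prop}
    (k : ℕ) (p : List V) (Y : Finset V) (hp : p ≠ []) (hpath : IsDipath A p)
    (hdisj : ∀ v ∈ p, v ∉ Y) (hzz : ∀ y ∈ Y, ZigzagFreeAt A y p) (hk : k ≤ p.length)
    (htight : ∀ S ⊆ p.toFinset, S.card = k → ∃ y ∈ Y, ∀ x ∈ S, DiAdj A y x) :
    ∃ P Q : List V, IsDipath A P ∧ IsDipath A Q ∧ (∀ v ∈ P, v ∉ Q) ∧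
      P.length + Q.length = p.length + k + 1 ∧ P.getLast? = p.getLast? ∧
      (∃ y ∈ Y, Q.getLast? = some y) ∧ (∀ v ∈ p, v ∈ P ∨ v ∈ Q) ∧
      (∀ v, v ∈ P ∨ v ∈ Q → v ∈ p ∨ v ∈ Y) := by
  classical
  induction k generalizing p Y with
  | zero =>
    obtain ⟨y, hy, -⟩ := htight ∅ (by simp) rfl
    refine ⟨p, [y], hpath, ⟨by simp, List.isChain_singleton y⟩, ?_, by simp, rfl,
      ⟨y, hy, rfl⟩, fun v hv => Or.inl hv, ?_⟩
    · intro v hv hvy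
      rw [List.mem_singleton] at hvy
      exact hdisj v hv (hvy ▸ hy)
    · rintro v (hv | hv)
      · exact Or.inl hv
      · rw [List.mem_singleton] at hv
        exact Or.inr (hv ▸ hy)
  | succ k ih =>
    have hout : ∃ x ∈ p, ∃ y ∈ Y, A x y := by
      obtain ⟨c, t, rfl⟩ := List.exists_cons_of_ne_nil hp
      obtain ⟨y, hy, hadj⟩ := exists_common_neighbor_of_length_le (q := [c]) hpath.1 hk htight
        (by simp) (by simp)
      exact ⟨c, by simp, y, hy, (hzz y hy).arc_to (l := [c]) (r := t) hadj c (by simp)⟩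
    obtain ⟨l, a, r, rfl, ⟨y, hy, hay⟩, hr⟩ := List.exists_split_at_last p hout
    obtain _ | ⟨b, r⟩ := r
    · exact absurd hay ((hzz y hy).2.1 a (by simp))
    push Not at hr
    have hsplit : l ++ a :: b :: r = (l ++ [a]) ++ b :: r := by simp
    rw [hsplit] at hp hpath hdisj hzz hk htight ⊢
    clear hout hsplit
    obtain ⟨hndq, hndr, hqr⟩ := List.nodup_append.1 hpath.1
    obtain ⟨hchq, hchr, -⟩ := List.isChain_append.1 hpath.2
    have hb_in : ∀ z ∈ Y, DiAdj A z b → A z b := fun z hz h =>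
      h.resolve_right (hr b (by simp) z hz)
    have hbreak : ∀ z ∈ Y, A z b → ¬ A a z := fun z hz hzb haz =>
      (List.isChain_append.1 (hzz z hz).2.2).2.2 a (by simp) b (by simp) ⟨haz, hzb⟩
    have hkq : k ≤ (l ++ [a]).length := by
      by_contra! hlt
      obtain ⟨z, hz, hadj⟩ := exists_common_neighbor_of_length_le (q := (l ++ [a]) ++ [b])
        hpath.1 hk htight (by intro v; simp; tauto) (by simp at hlt ⊢; omega)
      exact hbreak z hz (hb_in z hz (hadj b (by simp)))
        ((hzz z hz).arc_to (fun v hv => hadj v (by simp at hv ⊢; tauto)) a (by simp))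
    obtain ⟨P, Q, hP, hQ, hPQ, hlen, hPlast, ⟨z, hz, hQlast⟩, hcov, hsub⟩ :=
      ih (l ++ [a]) (Y.filter fun z => A z b) (by simp) ⟨hndq, hchq⟩
        (fun v hv hvY => hdisj v (by simp at hv ⊢; tauto) (Finset.mem_filter.1 hvY).1)
        (fun z hz => by
          obtain ⟨hz, hzb⟩ := Finset.mem_filter.1 hz
          refine ⟨fun v hv => (hzz z hz).1 v ?_, fun v hv => ?_,
            (List.isChain_append.1 (hzz z hz).2.2).1⟩
          · exact List.mem_head?_append_of_mem_head? hv
          · obtain rfl : a = v := by simpa using hv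
            exact hbreak z hz hzb)
        hkq
        (fun S hS hSk => by
          have hbS : b ∉ S := fun hb =>
            hqr b (List.mem_toFinset.1 (hS hb)) b (by simp) rfl
          obtain ⟨z, hz, hadj⟩ := htight (insert b S)
            (by
              intro v hv
              rcases Finset.mem_insert.1 hv with rfl | hv
              · simp
              · have := hS hv
                simp at this ⊢
                tauto)
            (by rw [Finset.card_insert_of_notMem hbS, hSk])
          exact ⟨z, Finset.mem_filter.2 ⟨hz, hb_in z hz (hadj b (by simp))⟩,
            fun x hx => hadj x (Finset.mem_insert_of_mem hx)⟩)
    obtain ⟨hzY, hzb⟩ := Finset.mem_filter.1 hz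
    have hnot : ∀ v, v ∈ P ∨ v ∈ Q → v ∉ b :: r ∧ v ≠ y := by
      intro v hv
      rcases hsub v hv with h | h
      · exact ⟨fun hvr => hqr v h v hvr rfl,
          fun hvy => hdisj v (List.mem_append_left _ h) (hvy ▸ hy)⟩
      · obtain ⟨hvY, hvb⟩ := Finset.mem_filter.1 h
        exact ⟨fun hvr => hdisj v (List.mem_append_right _ hvr) hvY,
          fun hvy => hbreak y hy (hvy ▸ hvb) hay⟩
    have hyr : y ∉ b :: r := fun h => hdisj y (List.mem_append_right _ h) hy
    refine ⟨Q ++ b :: r, P ++ [y],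
      hQ.append ⟨hndr, hchr⟩ (fun v hv => (hnot v (Or.inr hv)).1) hQlast rfl hzb,
      hP.append ⟨by simp, List.isChain_singleton y⟩
        (fun v hv h => (hnot v (Or.inl hv)).2 (List.mem_singleton.1 h))
        (hPlast.trans (by simp)) rfl hay, ?_, ?_, ?_, ⟨y, hy, by simp⟩, ?_, ?_⟩
    · intro v hv hv'
      rcases List.mem_append.1 hv with hv | hv <;> rcases List.mem_append.1 hv' with hv' | hv'
      · exact hPQ v hv' hv
      · exact (hnot v (Or.inr hv)).2 (List.mem_singleton.1 hv')
      · exact (hnot v (Or.inl hv')).1 hv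
      · exact hyr (List.mem_singleton.1 hv' ▸ hv)
    · simp only [List.length_append, List.length_cons, List.length_nil] at hlen ⊢
      omega
    · simp [List.getLast?_append, List.getLast?_cons]
    · intro v hv
      rcases List.mem_append.1 hv with hv | hv
      · rcases hcov v hv with h | h <;> simp [h]
      · exact Or.inl (List.mem_append_right _ hv)
    · have hsub' : ∀ v, v ∈ P ∨ v ∈ Q → v ∈ (l ++ [a]) ++ b :: r ∨ v ∈ Y := fun v hv =>
        (hsub v hv).imp (List.mem_append_left _) fun h => (Finset.mem_filter.1 h).1
      rintro v (hv | hv) <;> rcases List.mem_append.1 hv with hv | hv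
      · exact hsub' v (Or.inr hv)
      · exact Or.inl (List.mem_append_right _ hv)
      · exact hsub' v (Or.inl hv)
      · exact Or.inr (List.mem_singleton.1 hv ▸ hy)

/-- Let `k` be a positive integer, `D[X,Y]` a `k`-tight spine
digraph, and `p` a Hamiltonian path of `D[X]` that is zigzag-free in `D`. Then
there exist directed paths `P₁`, `P₂` of `D` such that: (i) they are
vertex-disjoint; (ii) `|P₁| + |P₂| = |X| + k + 1`; (iii) their set of terminal
vertices is `{last of p, y}` for some `y ∈ Y`; (iv) `X ⊆ V(P₁) ∪ V(P₂)`. -/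
theorem ktight_two_paths {V : Type*} [Fintype V] [DecidableEq V]
    (A : V → V → Prop) (hloopless : Irreflexive A)
    (X Y : Finset V) (hspine : IsSpinePartition A X Y)
    (k : ℕ) (hk : 0 < k) (htight : ¬ IsKLoose A k X Y)
    (p : List V) (hp : p ≠ [])
    (hpath : IsDipath A p) (hham : ∀ v : V, v ∈ p ↔ v ∈ X)
    (hzz : ZigzagFree A Y p) :
    ∃ P₁ P₂ : List V, IsDipath A P₁ ∧ IsDipath A P₂ ∧
      (∀ v : V, v ∈ P₁ → v ∉ P₂) ∧
      P₁.length + P₂.length = X.card + k + 1 ∧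
      (∃ y ∈ Y, ∃ h₁ : P₁ ≠ [], ∃ h₂ : P₂ ≠ [],
        ({P₁.getLast h₁, P₂.getLast h₂} : Set V) = {p.getLast hp, y}) ∧
      (∀ x ∈ X, x ∈ P₁ ∨ x ∈ P₂) := by
  have hpX : p.toFinset = X := by
    ext v
    rw [List.mem_toFinset, hham]
  have hlen : p.length = X.card := by rw [← hpX, List.toFinset_card_of_nodup hpath.1]
  unfold IsKLoose at htight
  push Not at htight
  obtain ⟨hcard, hcommon⟩ := htight
  obtain ⟨P, Q, hP, hQ, hPQ, hPQlen, hPlast, ⟨y, hy, hQlast⟩, hcov, -⟩ :=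
    exists_two_paths_of_zigzagFreeAt k p Y hp hpath
      (fun v hv => (hspine.1 v).1 ((hham v).1 hv)) (fun y hy => hzz.zigzagFreeAt hy)
      (hlen ▸ hcard) (hpX ▸ hcommon)
  rw [List.getLast?_eq_some_getLast hp] at hPlast
  obtain ⟨hPne, hPl⟩ := List.mem_getLast?_eq_getLast hPlast
  obtain ⟨hQne, hQl⟩ := List.mem_getLast?_eq_getLast hQlast
  exact ⟨P, Q, hP, hQ, hPQ, hlen ▸ hPQlen, ⟨y, hy, hPne, hQne, by rw [← hPl, ← hQl]⟩,
    fun x hx => hcov x ((hham x).2 hx)⟩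
end
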